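/- Let R be a group of operators for a finite group G such that every inner automorphism of G lies in the image of R in Aut G (Inn G ≤ Aut_R G). Then G is R-nilpotent if and only if, for every prime p and every p-subgroup P of G, Aut_R(P) = N_R(P)/C_R(P) is a p-group, where N_R(P) = {r ∈ R : P^r = P} and C_R(P) = {r ∈ R : x^r = x for all x ∈ P}. -/

import Mathlib

open Pointwise

/-- `opK φ n = Kₙ(G, R)`: `K₀ = G`, `Kₙ₊₁ = [Kₙ, R]` is generated by the `[x, r] = x⁻¹ · x^r`,
`x ∈ Kₙ(G, R)`, `r ∈ R`. -/
def opK {R G : Type*} [Group R] [Group G] (φ : R →* MulAut G) : ℕ → Subgroup G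
  | 0 => ⊤
  | n + 1 => Subgroup.closure {y | ∃ x ∈ opK φ n, ∃ r : R, y = x⁻¹ * φ r x}

/-- `N_R(P) = {r ∈ R : P^r = P}`. -/
def opN {R G : Type*} [Group R] [Group G] (φ : R →* MulAut G) (P : Subgroup G) : Subgroup R :=
  Subgroup.comap φ (MulAction.stabilizer (MulAut G) P)

/-- `C_R(P) = {r ∈ R : x^r = x for all x ∈ P}`. -/
def opC {R G : Type*} [Group R] [Group G] (φ : R →* MulAut G) (P : Subgroup G) : Subgroup R :=
  Subgroup.comap φ (⨅ x ∈ (P : Set G), MulAction.stabilizer (MulAut G) x)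

/-- `C_R(P)` is normal in `N_R(P)`, so the quotient group `Aut_R(P) = N_R(P)/C_R(P)` exists. -/
instance opC_normal_in_opN {R G : Type*} [Group R] [Group G] (φ : R →* MulAut G)
    (P : Subgroup G) : ((opC φ P).subgroupOf (opN φ P)).Normal := by
  constructor
  intro β hβ α
  simp only [Subgroup.mem_subgroupOf, opC, Subgroup.mem_comap, Subgroup.mem_iInf,
    MulAction.mem_stabilizer_iff] at hβ ⊢
  intro x hx
  have hα : φ (α : R) • P = P := α.2
  have hx' : (φ (α : R))⁻¹ • x ∈ P := by
    rw [← Subgroup.mem_pointwise_smul_iff_inv_smul_mem, hα]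
    exact hx
  have hfix := hβ _ hx'
  rw [Subgroup.coe_mul, Subgroup.coe_mul, Subgroup.coe_inv, map_mul, map_mul, map_inv]
  rw [mul_smul, mul_smul, hfix, smul_inv_smul]

/-- The nonidentity elements lying in some conjugate of `M`. -/
def nontrivialConjugates {G : Type*} [Group G] (M : Subgroup G) : Set G :=
  {y | y ≠ 1 ∧ ∃ g : G, ∃ x ∈ M, y = g * x * g⁻¹}

theorem isCoatom_conj_smul {G : Type*} [Group G] {M : Subgroup G} (hM : IsCoatom M) (g : G) :
    IsCoatom (MulAut.conj g • M) := by
  have h := Subgroup.isCoatom_comap_of_surjective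
    (φ := (MulAut.conj g⁻¹).toMonoidHom) (MulAut.conj g⁻¹).surjective hM
  convert h using 1
  ext x
  rw [Subgroup.mem_pointwise_smul_iff_inv_smul_mem]
  simp [MulAut.smul_def]

theorem conj_smul_eq_of_conj_eq {G : Type*} [Group G]
    (hT : ∀ M N : Subgroup G, IsCoatom M → IsCoatom N → M ≠ N → M ⊓ N = ⊥)
    {M L : Subgroup G} (hM : IsCoatom M) (hL : IsCoatom L) {g h x y : G} (hx : x ∈ M)
    (hy : y ∈ L) (hx1 : x ≠ 1) (hxy : g * x * g⁻¹ = h * y * h⁻¹) :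
    MulAut.conj (g⁻¹ * h) • L = M := by
  by_contra hne
  have h1 : x ∈ MulAut.conj (g⁻¹ * h) • L ⊓ M := by
    refine ⟨(Subgroup.mem_smul_pointwise_iff_exists _ _ _).2 ⟨y, hy, ?_⟩, hx⟩
    rw [MulAut.smul_def, MulAut.conj_apply]
    have : x = g⁻¹ * (g * x * g⁻¹) * g := by group
    rw [this, hxy]
    group
  rw [hT _ _ (isCoatom_conj_smul hL _) hM hne] at h1
  exact hx1 (by simpa using h1)

theorem mem_of_conj_smul_eq {G : Type*} [Group G] {M : Subgroup G} (hM : IsCoatom M)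
    (hn : ¬ M.Normal) {k : G} (hk : MulAut.conj k • M = M) : k ∈ M := by
  have hN : Subgroup.normalizer (M : Set G) = M := by
    rcases hM.le_iff.1 (Subgroup.le_normalizer (H := M)) with h | h
    · exact absurd (Subgroup.normalizer_eq_top_iff.1 h) hn
    · exact h
  rw [← hN, Subgroup.mem_normalizer_iff]
  intro x
  conv_rhs => rw [← hk, Subgroup.mem_pointwise_smul_iff_inv_smul_mem]
  simp [MulAut.smul_def, mul_assoc]

theorem ncard_nontrivialConjugates {G : Type*} [Group G] [Finite G]
    (hT : ∀ M N : Subgroup G, IsCoatom M → IsCoatom N → M ≠ N → M ⊓ N = ⊥)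
    {M : Subgroup G} (hM : IsCoatom M) (hn : ¬ M.Normal) :
    (nontrivialConjugates M).ncard = M.index * (Nat.card M - 1) := by
  let f : (G ⧸ M) × {x : M // x ≠ 1} → G := fun q => q.1.out * (q.2 : M) * q.1.out⁻¹
  have hf : Function.Injective f := by
    rintro ⟨a, ⟨x, hx⟩, hx1⟩ ⟨b, ⟨y, hy⟩, hy1⟩ hab
    have hab' : a.out * x * a.out⁻¹ = b.out * y * b.out⁻¹ := hab
    have hk := mem_of_conj_smul_eq hM hn (conj_smul_eq_of_conj_eq hT hM hM hx hy
      (by simpa using hx1) hab')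
    have : a = b := by
      rw [← QuotientGroup.out_eq' a, ← QuotientGroup.out_eq' b]
      exact QuotientGroup.eq.2 hk
    subst this
    simpa using hab'
  have hr : Set.range f = nontrivialConjugates M := by
    ext y
    constructor
    · rintro ⟨⟨a, ⟨x, hx⟩, hx1⟩, rfl⟩
      exact ⟨fun h => hx1 (by simpa [f] using h), _, x, hx, rfl⟩
    · rintro ⟨hy1, g, x, hx, rfl⟩
      obtain ⟨m, hm⟩ := QuotientGroup.mk_out_eq_mul M g
      have hx1 : x ≠ 1 := fun h => hy1 (by simp [h])
      refine ⟨⟨(g : G ⧸ M), ⟨(m : G)⁻¹ * x * m,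
        M.mul_mem (M.mul_mem (M.inv_mem m.2) hx) m.2⟩, ?_⟩, ?_⟩
      · intro h
        apply hx1
        have h' := congrArg Subtype.val h
        simpa using conj_eq_one_iff (a := (m : G)⁻¹) (b := x) |>.1 (by simpa using h')
      · simp only [f, hm]
        group
  rw [← hr, ← Nat.card_coe_set_eq, Nat.card_range_of_injective hf, Nat.card_prod]
  congr 1
  have h2 := Set.ncard_compl ({1} : Set M)
  rw [Set.ncard_singleton] at h2
  rw [← h2, ← Nat.card_coe_set_eq]
  rfl

/-- A nontrivial finite group whose maximal subgroups intersect pairwise trivially has a normal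
maximal subgroup. -/
theorem exists_normal_coatom_of_inf_eq_bot {G : Type*} [Group G] [Finite G] [Nontrivial G]
    (hT : ∀ M N : Subgroup G, IsCoatom M → IsCoatom N → M ≠ N → M ⊓ N = ⊥) :
    ∃ M : Subgroup G, IsCoatom M ∧ M.Normal := by
  by_contra! hcon
  have hcard : ∀ M : Subgroup G, IsCoatom M →
      Nat.card G ≤ 2 * (nontrivialConjugates M).ncard ∧
        (nontrivialConjugates M).ncard + 2 ≤ Nat.card G := by
    intro M hM
    rw [ncard_nontrivialConjugates hT hM (hcon M hM)]
    have h1 := M.card_mul_index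
    have h2 : 1 < M.index := M.one_lt_index_of_ne_top hM.1
    have h3 : 1 < Nat.card M := by
      rw [Subgroup.one_lt_card_iff_ne_bot]
      rintro rfl
      exact hcon _ hM inferInstance
    obtain ⟨c, hc⟩ := Nat.exists_eq_add_of_lt h3
    rw [← h1, hc]
    have : 1 + c + 1 - 1 = c + 1 := by omega
    rw [this]
    constructor <;> nlinarith
  have hsub : ∀ M : Subgroup G, nontrivialConjugates M ⊆ {1}ᶜ := fun M y hy => hy.1
  have hone : ({1}ᶜ : Set G).ncard = Nat.card G - 1 := by
    rw [Set.ncard_compl, Set.ncard_singleton]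
  obtain ⟨M, hM, -⟩ := (eq_top_or_exists_le_coatom (⊥ : Subgroup G)).resolve_left bot_ne_top
  obtain ⟨y, hy1, hyM⟩ : ∃ y ∈ ({1}ᶜ : Set G), y ∉ nontrivialConjugates M := by
    by_contra! h
    have h1 := Set.ncard_le_ncard (fun y hy => h y hy : ({1}ᶜ : Set G) ⊆ nontrivialConjugates M)
    have := (hcard M hM).2
    omega
  obtain ⟨L, hL, hyL⟩ := (eq_top_or_exists_le_coatom (Subgroup.zpowers y)).resolve_left (by
    intro h
    refine hcon M hM ⟨fun n hn g => ?_⟩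
    obtain ⟨i, rfl⟩ := Subgroup.mem_zpowers_iff.1 (h ▸ Subgroup.mem_top n)
    obtain ⟨j, rfl⟩ := Subgroup.mem_zpowers_iff.1 (h ▸ Subgroup.mem_top g)
    rwa [(Commute.zpow_zpow_self y j i).eq, mul_inv_cancel_right])
  have hyL' : y ∈ L := hyL (Subgroup.mem_zpowers y)
  have hdisj : Disjoint (nontrivialConjugates M) (nontrivialConjugates L) := by
    rw [Set.disjoint_left]
    rintro _ ⟨hz1, g, x, hx, rfl⟩ ⟨-, h, x', hx', hxx⟩
    have hML := conj_smul_eq_of_conj_eq hT hM hL hx hx' (fun h => hz1 (by simp [h])) hxx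
    refine hyM ⟨hy1, (g⁻¹ * h)⁻¹, MulAut.conj (g⁻¹ * h) • y, ?_, ?_⟩
    · rw [← hML]
      exact Subgroup.smul_mem_pointwise_smul _ _ _ hyL'
    · rw [MulAut.smul_def, MulAut.conj_apply]
      group
  have hu := Set.ncard_union_eq hdisj
  have hle := Set.ncard_le_ncard (Set.union_subset (hsub M) (hsub L))
  have := hcard M hM
  have := hcard L hL
  have := Nat.card_pos (α := G)
  omega

/-- A nontrivial finite group all of whose proper subgroups are nilpotent has a normal maximal
subgroup. -/
theorem exists_normal_coatom_of_forall_isNilpotent {G : Type*} [Group G] [Finite G] [Nontrivial G]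
    (hG : ∀ H : Subgroup G, H < ⊤ → Group.IsNilpotent H) :
    ∃ M : Subgroup G, IsCoatom M ∧ M.Normal := by
  induction hc : Nat.card G using Nat.strong_induction_on generalizing G with
  | _ c ih =>
  subst hc
  by_cases hs : ∃ N : Subgroup G, N.Normal ∧ N ≠ ⊥ ∧ N ≠ ⊤
  · obtain ⟨N, hN, hb, ht⟩ := hs
    have : Nontrivial (G ⧸ N) := QuotientGroup.nontrivial_iff.2 ht
    have hsurj := QuotientGroup.mk'_surjective N
    obtain ⟨M, hM, hMn⟩ := ih (Nat.card (G ⧸ N)) (by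
        have h1 := N.card_mul_index
        have h2 := (Subgroup.one_lt_card_iff_ne_bot N).2 hb
        have h3 : 0 < N.index := Nat.pos_of_ne_zero N.index_ne_zero_of_finite
        change N.index < _
        nlinarith) (fun H hH => by
        have := hG (H.comap (QuotientGroup.mk' N)) (lt_top_iff_ne_top.2 fun h => hH.ne (by
          rw [← Subgroup.map_comap_eq_self_of_surjective hsurj H, h,
            Subgroup.map_top_of_surjective _ hsurj]))
        exact Group.nilpotent_of_surjective ((QuotientGroup.mk' N).subgroupComap H)
          ((QuotientGroup.mk' N).subgroupComap_surjective_of_surjective H hsurj)) rfl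
    exact ⟨M.comap (QuotientGroup.mk' N), Subgroup.isCoatom_comap_of_surjective hsurj hM,
      inferInstance⟩
  · push Not at hs
    by_contra! hcon
    obtain ⟨M, N, hM, hN, hMN, hne⟩ : ∃ M N : Subgroup G, IsCoatom M ∧ IsCoatom N ∧ M ≠ N ∧
        M ⊓ N ≠ ⊥ := by
      by_contra! h
      obtain ⟨M, hM, hMn⟩ := exists_normal_coatom_of_inf_eq_bot h
      exact hcon M hM hMn
    obtain ⟨D, ⟨hDb, M, N, hM, hN, hMN, rfl⟩, hmax⟩ :=
      (Set.toFinite {D : Subgroup G | D ≠ ⊥ ∧ ∃ M N : Subgroup G, IsCoatom M ∧ IsCoatom N ∧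
        M ≠ N ∧ D = M ⊓ N}).exists_maximal ⟨M ⊓ N, hne, M, N, hM, hN, hMN, rfl⟩
    obtain ⟨L, hL, hnL⟩ := (eq_top_or_exists_le_coatom
      (Subgroup.normalizer ((M ⊓ N : Subgroup G) : Set G))).resolve_left (fun h => by
        have := hs _ (Subgroup.normalizer_eq_top_iff.1 h) hDb
        exact hM.1 (top_le_iff.1 (this ▸ inf_le_left)))
    have key : ∀ K : Subgroup G, IsCoatom K → M ⊓ N < K → K = L := by
      intro K hK hlt
      by_contra hKL
      have := hG K hK.lt_top
      have hlt' : (M ⊓ N).subgroupOf K < ⊤ :=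
        lt_top_iff_ne_top.2 fun h => hlt.not_ge (Subgroup.subgroupOf_eq_top.1 h)
      have h1 := Group.normalizerCondition_of_isNilpotent (G := K) _ hlt'
      rw [← Subgroup.subgroupOf_normalizer_eq hlt.le] at h1
      obtain ⟨x, hx, hxn⟩ := SetLike.exists_of_lt h1
      have hle : M ⊓ N ≤ K ⊓ L :=
        le_inf hlt.le (Subgroup.le_normalizer.trans hnL)
      have h2 := hmax ⟨fun h => hDb (le_bot_iff.1 (h ▸ hle)), K, L, hK, hL, hKL, rfl⟩ hle
      exact hxn (h2 ⟨x.2, hnL hx⟩)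
    have hM' := key M hM (lt_of_le_of_ne inf_le_left fun h =>
      (hM.le_iff.1 (inf_eq_left.1 h)).elim hN.1 fun h => hMN h.symm)
    have hN' := key N hN (lt_of_le_of_ne inf_le_right fun h =>
      (hN.le_iff.1 (inf_eq_right.1 h)).elim hM.1 hMN)
    exact hMN (hM'.trans hN'.symm)

theorem Subgroup.eq_top_of_exists_sylow_le {G : Type*} [Group G] [Finite G] {H : Subgroup G}
    (h : ∀ (p : ℕ) [Fact p.Prime], ∃ P : Sylow p G, (P : Subgroup G) ≤ H) : H = ⊤ := by
  rw [← Subgroup.index_eq_one]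
  by_contra hne
  obtain ⟨p, hp, hpd⟩ := Nat.exists_prime_and_dvd hne
  have : Fact p.Prime := ⟨hp⟩
  obtain ⟨P, hP⟩ := h p
  exact P.not_dvd_index (hpd.trans (Subgroup.index_dvd_of_le hP))

theorem Subgroup.mem_of_pow_mem_of_coprime {G : Type*} [Group G] {H : Subgroup G} {x : G} {n : ℕ}
    (hn : n.Coprime (orderOf x)) (hx : x ^ n ∈ H) : x ∈ H := by
  obtain ⟨m, hm⟩ := exists_pow_eq_self_of_coprime hn
  rw [← hm]
  exact H.pow_mem hx m

/-- A finite group `G` is nilpotent if `N_G(P)/C_G(P)` is a `p`-group for every prime `p` and every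
`p`-subgroup `P`. -/
theorem isNilpotent_of_forall_normalizer_pow_commute {G : Type*} [Group G] [Finite G]
    (hF : ∀ p : ℕ, p.Prime → ∀ P : Subgroup G, IsPGroup p P →
      ∀ g ∈ Subgroup.normalizer (P : Set G), ∃ k : ℕ, ∀ x ∈ P, Commute (g ^ p ^ k) x) :
    Group.IsNilpotent G := by
  induction hc : Nat.card G using Nat.strong_induction_on generalizing G with
  | _ c ih =>
  subst hc
  have hsub : ∀ H : Subgroup G, H < ⊤ → Group.IsNilpotent H := by
    intro H hH
    refine ih (Nat.card H) ?_ ?_ rfl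
    · exact lt_of_le_of_ne (Subgroup.card_le_card_group H) fun h =>
        hH.ne (H.eq_top_of_card_eq h)
    · intro p hp P hP g hg
      obtain ⟨k, hk⟩ := hF p hp (P.map H.subtype) (hP.map _) g (by
        rw [Subgroup.mem_normalizer_iff] at hg ⊢
        intro x
        constructor
        · rintro ⟨y, hy, rfl⟩
          exact ⟨g * y * g⁻¹, (hg y).1 hy, by simp⟩
        · rintro ⟨y, hy, hyx⟩
          refine ⟨g⁻¹ * y * g, (hg _).2 (by simpa [mul_assoc] using hy), ?_⟩
          have hyx' : (y : G) = g * x * g⁻¹ := hyx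
          simp [hyx', mul_assoc])
      exact ⟨k, fun x hx => Subtype.ext (by simpa using (hk x ⟨x, hx, rfl⟩).eq)⟩
  rcases subsingleton_or_nontrivial G with hG | hG
  · infer_instance
  obtain ⟨M, hM, hMn⟩ := exists_normal_coatom_of_forall_isNilpotent hsub
  have hMnil := hsub M hM.lt_top
  obtain ⟨q, hq, Q, hQ⟩ : ∃ (q : ℕ) (_ : Fact q.Prime) (Q : Sylow q G), ¬ (Q : Subgroup G) ≤ M := by
    by_contra! h
    exact hM.1 (Subgroup.eq_top_of_exists_sylow_le fun p hp => ⟨default, h p hp _⟩)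
  have hMQ : (Q : Subgroup G) ⊔ M = ⊤ :=
    hM.2 _ (lt_of_le_of_ne le_sup_right fun h => hQ (h ▸ le_sup_left))
  have hidx : M.index ∣ Nat.card Q := by
    rw [← Subgroup.relIndex_top_right, ← hMQ, Subgroup.relIndex_sup_right]
    exact Subgroup.relIndex_dvd_card _ _
  have hnormal : ∀ (p : ℕ) [Fact p.Prime] (P : Sylow p G), p ≠ q → (P : Subgroup G).Normal := by
    intro p _ P hpq
    have hPM : (P : Subgroup G) ≤ M := fun x hx => by
      refine Subgroup.mem_of_pow_mem_of_coprime (n := M.index) ?_ (M.pow_index_mem x)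
      exact Nat.Coprime.of_dvd hidx (Subgroup.orderOf_dvd_natCard _ hx)
        (IsPGroup.coprime_card_of_ne q p hpq.symm _ _ Q.2 P.2)
    have h1 : ((P.subtype hPM : Sylow p M) : Subgroup M).Normal := inferInstance
    have h2 := Sylow.characteristic_of_normal _ h1
    rw [← Subgroup.map_subgroupOf_eq_of_le hPM]
    exact ConjAct.normal_of_characteristic_of_normal (K := (P.subtype hPM : Subgroup M))
  have hcomm : ∀ (p : ℕ) [Fact p.Prime] (P : Sylow p G), p ≠ q → ∀ x ∈ P, ∀ g ∈ Q,
      Commute g x := by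
    intro p hp P hpq x hx g hg
    have := hnormal p P hpq
    obtain ⟨k, hk⟩ := hF p hp.1 P P.2 g (by
      rw [Subgroup.normalizer_eq_top_iff.2 this]
      exact Subgroup.mem_top g)
    have hcop : (p ^ k).Coprime (orderOf g) := by
      obtain ⟨l, hl⟩ := IsPGroup.iff_card.1 Q.2
      refine Nat.Coprime.coprime_dvd_right (Subgroup.orderOf_dvd_natCard _ hg) ?_
      rw [hl]
      exact Nat.Coprime.pow _ _ ((Nat.coprime_primes hp.1 hq.1).2 hpq)
    exact (Subgroup.mem_centralizer_singleton_iff.1 (Subgroup.mem_of_pow_mem_of_coprime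
      (H := Subgroup.centralizer {x}) hcop (Subgroup.mem_centralizer_singleton_iff.2 (hk x hx).eq)))
  have hQn : (Q : Subgroup G).Normal := by
    rw [← Subgroup.normalizer_eq_top_iff]
    refine Subgroup.eq_top_of_exists_sylow_le fun p hp => ?_
    by_cases hpq : p = q
    · subst hpq
      exact ⟨Q, Subgroup.le_normalizer⟩
    · obtain ⟨P⟩ : Nonempty (Sylow p G) := inferInstance
      refine ⟨P, fun x hx => Subgroup.mem_normalizer_iff.2 fun g => ⟨fun hg => ?_, fun hg => ?_⟩⟩
      · rwa [← (hcomm p P hpq x hx g hg).eq, mul_inv_cancel_right]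
      · have h := (hcomm p P hpq x hx _ hg).eq
        rw [inv_mul_cancel_right] at h
        rwa [← mul_left_cancel h] at hg
  refine (Group.isNilpotent_of_finite_tfae.out 0 3 rfl rfl).2 fun p hp P => ?_
  by_cases hpq : p = q
  · subst hpq
    obtain ⟨g, rfl⟩ := MulAction.exists_smul_eq G Q P
    rwa [Sylow.smul_eq_of_normal]
  · exact hnormal p P hpq

theorem isPGroup_opN_quotient_opC_iff {R G : Type*} [Group R] [Group G] (φ : R →* MulAut G)
    (P : Subgroup G) (p : ℕ) :
    IsPGroup p (↥(opN φ P) ⧸ (opC φ P).subgroupOf (opN φ P)) ↔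
      ∀ r ∈ opN φ P, ∃ k : ℕ, ∀ x ∈ P, φ (r ^ p ^ k) x = x := by
  have key : ∀ (r : opN φ P) (k : ℕ),
      (r : ↥(opN φ P) ⧸ (opC φ P).subgroupOf (opN φ P)) ^ p ^ k = 1 ↔
        ∀ x ∈ P, φ ((r : R) ^ p ^ k) x = x := by
    intro r k
    rw [← QuotientGroup.mk_pow, QuotientGroup.eq_one_iff]
    simp [Subgroup.mem_subgroupOf, opC, MulAut.smul_def]
  constructor
  · intro h r hr
    obtain ⟨k, hk⟩ := h ((⟨r, hr⟩ : opN φ P) : ↥(opN φ P) ⧸ (opC φ P).subgroupOf (opN φ P))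
    exact ⟨k, (key ⟨r, hr⟩ k).1 hk⟩
  · intro h q
    induction q using QuotientGroup.induction_on with
    | H r =>
      obtain ⟨k, hk⟩ := h r r.2
      exact ⟨k, (key r k).2 hk⟩

theorem apply_mem_of_mem_opN {R G : Type*} [Group R] [Group G] {φ : R →* MulAut G}
    {P : Subgroup G} {r : R} (hr : r ∈ opN φ P) {x : G} (hx : x ∈ P) : φ r x ∈ P := by
  have h : φ r • P = P := hr
  rw [← h]
  exact Subgroup.smul_mem_pointwise_smul _ _ _ hx

/-- If `G` is `R`-nilpotent then `Aut_R(P)` is a `p`-group for every `p`-subgroup `P`. -/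
theorem isPGroup_opN_quotient_opC_of_opK_eq_bot {R G : Type*} [Group R] [Group G] [Finite G]
    (φ : R →* MulAut G) {n : ℕ} (hn : opK φ n = ⊥) {p : ℕ} (hp : p.Prime) {P : Subgroup G}
    (hP : IsPGroup p P) : IsPGroup p (↥(opN φ P) ⧸ (opC φ P).subgroupOf (opN φ P)) := by
  have : Fact p.Prime := ⟨hp⟩
  obtain ⟨l, hl⟩ := IsPGroup.iff_card.1 hP
  rw [isPGroup_opN_quotient_opC_iff]
  intro r hr
  have key : ∀ j m : ℕ, m + j = n → ∀ x ∈ opK φ m, x ∈ P → φ (r ^ (p ^ l) ^ j) x = x := by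
    intro j
    induction j with
    | zero =>
      rintro m rfl x hx -
      rw [add_zero] at hn
      rw [hn, Subgroup.mem_bot] at hx
      rw [hx, map_one]
    | succ j ih =>
      intro m hm x hx hxP
      obtain ⟨s, hs⟩ : ∃ s, s = r ^ (p ^ l) ^ j := ⟨_, rfl⟩
      rw [← hs] at ih
      have hsP : s ∈ opN φ P := hs ▸ (opN φ P).pow_mem hr _
      obtain ⟨c, hc⟩ : ∃ c, c = x⁻¹ * φ s x := ⟨_, rfl⟩
      have hcP : c ∈ P := hc ▸ P.mul_mem (P.inv_mem hxP) (apply_mem_of_mem_opN hsP hxP)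
      have hcs : φ s c = c :=
        ih (m + 1) (by omega) c (Subgroup.subset_closure ⟨x, hx, s, hc⟩) hcP
      have hpow : ∀ i : ℕ, φ (s ^ i) x = x * c ^ i := by
        intro i
        induction i with
        | zero => simp
        | succ i ihi =>
          rw [pow_succ', map_mul, MulAut.mul_apply, ihi, map_mul, map_pow, hcs, pow_succ',
            ← mul_assoc, hc, mul_inv_cancel_left]
      have hcard : c ^ Nat.card P = 1 :=
        congrArg Subtype.val (pow_card_eq_one' (x := (⟨c, hcP⟩ : P)))
      rw [pow_succ, pow_mul, ← hs, hpow, ← hl, hcard, mul_one]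
  exact ⟨l * n, fun x hx => by
    rw [pow_mul]
    exact key n 0 (zero_add n) x trivial hx⟩

/-- The elements of `G` whose image in `G ⧸ Z` is fixed by `R`. -/
def opFixedMod {R G : Type*} [Group R] [Group G] (φ : R →* MulAut G) (Z : Subgroup G)
    [Z.Normal] : Subgroup G where
  carrier := {x | ∀ r : R, x⁻¹ * φ r x ∈ Z}
  one_mem' r := by simp
  mul_mem' {x y} hx hy r := by
    have h := Z.mul_mem (Subgroup.Normal.conj_mem' inferInstance _ (hx r) y) (hy r)
    rw [map_mul]
    convert h using 1
    group
  inv_mem' {x} hx r := by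
    have h := Subgroup.Normal.conj_mem inferInstance _ (Z.inv_mem (hx r)) x
    rw [map_inv]
    convert h using 1
    group

/-- A group acting as a `p`-group on a `p`-subgroup `P` not contained in the invariant normal
subgroup `Z` fixes a nontrivial element of the image of `P` in `G ⧸ Z`. -/
theorem exists_mem_opFixedMod_notMem {R G : Type*} [Group R] [Group G] [Finite G]
    (φ : R →* MulAut G) {p : ℕ} (hp : p.Prime) {P Z : Subgroup G} [Z.Normal] (hP : IsPGroup p P)
    (hPinv : ∀ r, ∀ x ∈ P, φ r x ∈ P) (hZinv : ∀ r, ∀ x ∈ Z, φ r x ∈ Z)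
    (hR : ∀ r, ∃ k : ℕ, ∀ x ∈ P, φ (r ^ p ^ k) x = x) (hPZ : ¬ P ≤ Z) :
    ∃ x ∈ opFixedMod φ Z, x ∉ Z := by
  have : Fact p.Prime := ⟨hp⟩
  let Q : Subgroup (G ⧸ Z) := P.map (QuotientGroup.mk' Z)
  let act : R → G ⧸ Z →* G ⧸ Z := fun r => QuotientGroup.map Z Z (φ r : G →* G) (hZinv r)
  have act_mk : ∀ (r : R) (x : G), act r (x : G ⧸ Z) = (φ r x : G) := fun r x => rfl
  have hQ : ∀ r, ∀ q ∈ Q, act r q ∈ Q := by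
    rintro r _ ⟨x, hx, rfl⟩
    exact ⟨φ r x, hPinv r x hx, rfl⟩
  let _ : MulAction R Q :=
    { smul := fun r q => ⟨act r q, hQ r q q.2⟩
      one_smul := by
        rintro ⟨_, x, hx, rfl⟩
        refine Subtype.ext ?_
        change act 1 (x : G ⧸ Z) = x
        rw [act_mk, map_one, MulAut.one_apply]
      mul_smul := by
        rintro r s ⟨_, x, hx, rfl⟩
        refine Subtype.ext ?_
        change act (r * s) (x : G ⧸ Z) = act r (act s (x : G ⧸ Z))
        rw [act_mk, act_mk, act_mk, map_mul, MulAut.mul_apply] }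
  have smul_val : ∀ (r : R) (q : Q), ((r • q : Q) : G ⧸ Z) = act r q := fun _ _ => rfl
  have hA : IsPGroup p (MulAction.toPermHom R Q).range := by
    rintro ⟨_, r, rfl⟩
    obtain ⟨k, hk⟩ := hR r
    refine ⟨k, Subtype.ext ?_⟩
    change MulAction.toPermHom R Q r ^ p ^ k = 1
    rw [← map_pow]
    ext ⟨_, x, hx, rfl⟩
    change act (r ^ p ^ k) (x : G ⧸ Z) = x
    rw [act_mk, hk x hx]
  have hQp : p ∣ Nat.card Q := by
    refine (hP.map _).card_eq_or_dvd.resolve_left fun h => hPZ ?_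
    have := (Subgroup.map_eq_bot_iff _).1 (Subgroup.card_eq_one.1 h)
    rwa [QuotientGroup.ker_mk'] at this
  obtain ⟨⟨_, x, hx, rfl⟩, hb, hne⟩ :=
    hA.exists_fixed_point_of_prime_dvd_card_of_fixed_point Q hQp (a := 1) (by
      rintro ⟨_, r, rfl⟩
      exact Subtype.ext (map_one (act r)))
  refine ⟨x, fun r => ?_, fun hxZ => hne (Subtype.ext ?_)⟩
  · have h := congrArg Subtype.val (hb ⟨_, r, rfl⟩)
    exact QuotientGroup.eq.1 (show (x : G ⧸ Z) = (φ r x : G) from h.symm)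
  · exact ((QuotientGroup.eq_one_iff x).2 hxZ).symm

theorem Sylow.apply_mem_of_normal {G : Type*} [Group G] [Finite G] {p : ℕ} [Fact p.Prime]
    (P : Sylow p G) (hP : (P : Subgroup G).Normal) (f : MulAut G) {x : G} (hx : x ∈ P) :
    f x ∈ P := by
  have := Subgroup.characteristic_iff_map_eq.1 (P.characteristic_of_normal hP) f
  have h : f x ∈ (P : Subgroup G).map f.toMonoidHom := ⟨x, hx, rfl⟩
  rwa [this] at h

theorem exists_opK_eq_bot {R G : Type*} [Group R] [Group G] [Finite G]
    (φ : R →* MulAut G) (hInn : ∀ g : G, MulAut.conj g ∈ φ.range)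
    (h : ∀ p : ℕ, p.Prime → ∀ P : Subgroup G, IsPGroup p P →
      ∀ r ∈ opN φ P, ∃ k : ℕ, ∀ x ∈ P, φ (r ^ p ^ k) x = x) :
    ∃ n : ℕ, opK φ n = ⊥ := by
  have hnil : Group.IsNilpotent G := by
    refine isNilpotent_of_forall_normalizer_pow_commute fun p hp P hP g hg => ?_
    obtain ⟨r, hr⟩ := hInn g
    obtain ⟨k, hk⟩ := h p hp P hP r (by
      change φ r • P = P
      ext x
      rw [Subgroup.mem_pointwise_smul_iff_inv_smul_mem, hr, Subgroup.mem_normalizer_iff.1 hg]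
      simp [MulAut.smul_def, mul_assoc])
    refine ⟨k, fun x hx => ?_⟩
    have hx' := hk x hx
    rw [map_pow, hr, ← map_pow, MulAut.conj_apply] at hx'
    exact mul_inv_eq_iff_eq_mul.1 hx'
  obtain ⟨Z, ⟨hZ, n, hn⟩, hmax⟩ := (Set.toFinite {Z : Subgroup G | (∀ r, ∀ x ∈ Z, φ r x ∈ Z) ∧
    ∃ n, ∀ m, opK φ m ≤ Z → opK φ (m + n) = ⊥}).exists_maximal
      ⟨⊥, by simp, 0, fun m hm => le_bot_iff.1 hm⟩
  have hZn : Z.Normal := ⟨fun x hx g => by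
    obtain ⟨r, hr⟩ := hInn g
    rw [← MulAut.conj_apply, ← hr]
    exact hZ r x hx⟩
  have hle : opFixedMod φ Z ≤ Z := by
    refine hmax ⟨fun r x hx s => ?_, n + 1, fun m hm => ?_⟩ fun x hx r =>
      Z.mul_mem (Z.inv_mem hx) (hZ r x hx)
    · have h1 := hZ r _ (hx (r⁻¹ * s * r))
      rw [map_mul, map_inv, ← MulAut.mul_apply, ← map_mul] at h1
      rw [← MulAut.mul_apply, ← map_mul]
      convert h1 using 4
      group
    · have h1 : opK φ (m + 1) ≤ Z := by
        refine (Subgroup.closure_le _).2 ?_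
        rintro _ ⟨x, hx, r, rfl⟩
        exact hm hx r
      rw [← hn _ h1]
      congr 1
      omega
  have htop : Z = ⊤ := Subgroup.eq_top_of_exists_sylow_le fun p hp => by
    obtain ⟨P⟩ : Nonempty (Sylow p G) := inferInstance
    refine ⟨P, ?_⟩
    by_contra hPZ
    have hPn : (P : Subgroup G).Normal := inferInstance
    have hPinv : ∀ r, ∀ x ∈ (P : Subgroup G), φ r x ∈ (P : Subgroup G) := fun r x hx =>
      P.apply_mem_of_normal hPn _ hx
    obtain ⟨x, hx, hxZ⟩ := exists_mem_opFixedMod_notMem φ hp.1 P.2 hPinv hZ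
      (fun r => h p hp.1 P P.2 r (by
        change φ r • (P : Subgroup G) = P
        ext x
        rw [Subgroup.mem_pointwise_smul_iff_inv_smul_mem]
        refine ⟨fun hx => ?_, fun hx => ?_⟩
        · simpa [MulAut.smul_def] using hPinv r _ hx
        · simpa [MulAut.smul_def] using hPinv r⁻¹ _ hx)) hPZ
    exact hxZ (hle hx)
  exact ⟨0 + n, hn 0 (htop ▸ le_top)⟩

/-- Let `R` be a group of operators for a finite group `G` (acting via `φ : R →* Aut G`) such
that every inner automorphism of `G` lies in `φ(R)`. Then `G` is `R`-nilpotent iff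
`Aut_R(P) = N_R(P)/C_R(P)` is a `p`-group for every prime `p` and every `p`-subgroup `P`
of `G`. -/
theorem opNilpotent_iff_frobenius_condition (R G : Type*) [Group R] [Group G] [Finite R]
    [Finite G] (φ : R →* MulAut G) (hInn : ∀ g : G, MulAut.conj g ∈ φ.range) :
    (∃ n : ℕ, opK φ n = ⊥) ↔
      ∀ (p : ℕ), p.Prime → ∀ P : Subgroup G, IsPGroup p P →
        IsPGroup p (↥(opN φ P) ⧸ (opC φ P).subgroupOf (opN φ P)) := by
  simp only [isPGroup_opN_quotient_opC_iff]
  constructor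
  · rintro ⟨n, hn⟩ p hp P hP
    exact (isPGroup_opN_quotient_opC_iff φ P p).1
      (isPGroup_opN_quotient_opC_of_opK_eq_bot φ hn hp hP)
  · exact exists_opK_eq_bot φ hInn
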